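/- Let A ⊆ ℕ be a nonempty set with A ≠ {1} and let C ⊆ ℕ be nonempty. For P a partition, let ζ_C(P) denote the number of blocks of P whose size belongs to C, and set π_A(C) = Σ_{k∈C} π_A(k). Then, as n → ∞ along the set of integers n for which ℕℂ^A_n is nonempty: (a) for every ε > 0, the proportion #{P ∈ ℕℂ^A_n : |ζ_C(P)/n − π_A(C)| > ε} / #ℕℂ^A_n tends to 0 (convergence in probability of ζ_C/n to π_A(C) under the uniform measure on ℕℂ^A_n); and (b) the average (1/(n·#ℕℂ^A_n))·Σ_{P ∈ ℕℂ^A_n} ζ_C(P) tends to π_A(C). -/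

import Mathlib

open scoped Classical

/-- `P` is a set partition of `[n] = {1, …, n}`: its blocks are nonempty subsets of
`{1, …, n}` and every element of `{1, …, n}` lies in exactly one block. -/
def IsPartitionOf (n : ℕ) (P : Finset (Finset ℕ)) : Prop :=
  (∀ B ∈ P, B ⊆ Finset.Icc 1 n ∧ B.Nonempty) ∧
    ∀ x ∈ Finset.Icc 1 n, ∃! B, B ∈ P ∧ x ∈ B

/-- A partition is non-crossing when there are no `a < b < c < d` with `a, c` in one
block and `b, d` in another, distinct block. -/
def IsNonCrossing (P : Finset (Finset ℕ)) : Prop :=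
  ∀ B ∈ P, ∀ B' ∈ P, B ≠ B' →
    ∀ a b c d : ℕ, a < b → b < c → c < d →
      a ∈ B → c ∈ B → b ∈ B' → d ∈ B' → False

/-- The (finite) set of non-crossing partitions of `[n]`. -/
noncomputable def NCP (n : ℕ) : Finset (Finset (Finset ℕ)) :=
  (Finset.Icc 1 n).powerset.powerset.filter fun P => IsPartitionOf n P ∧ IsNonCrossing P

/-- The set of non-crossing partitions of `[n]` all of whose block sizes belong to `A`. -/
noncomputable def NCPA (A : Set ℕ) (n : ℕ) : Finset (Finset (Finset ℕ)) :=
  (NCP n).filter fun P => ∀ B ∈ P, B.card ∈ A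

/-- The probability measure `π_A` on `ℤ₊` associated with `A` and `ξ = ξ_A`. -/
noncomputable def piA (A : Set ℕ) (ξ : ℝ) (k : ℕ) : ℝ :=
  if k = 0 ∨ k ∈ A then ξ ^ k / (1 + ∑' i : A, ξ ^ (i : ℕ)) else 0

/-- An open configuration on the ground set `S`: a non-crossing family `P` of disjoint nonempty
blocks, together with the set `D` of the elements of `S` not covered by `P`, such that no element
of `D` is nested inside a block. -/
structure IsOpenConfig (S : Finset ℕ) (P : Finset (Finset ℕ)) (D : Finset ℕ) : Prop where
  subset : ∀ B ∈ P, B ⊆ S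
  nonempty : ∀ B ∈ P, B.Nonempty
  subset' : D ⊆ S
  eq_of_mem : ∀ B ∈ P, ∀ B' ∈ P, ∀ x ∈ B, x ∈ B' → B = B'
  notMem : ∀ B ∈ P, ∀ x ∈ B, x ∉ D
  cover : ∀ x ∈ S, x ∈ D ∨ ∃ B ∈ P, x ∈ B
  nonCrossing : IsNonCrossing P
  outer : ∀ B ∈ P, ∀ a ∈ B, ∀ c ∈ B, ∀ b ∈ D, a < b → b < c → False

namespace IsOpenConfig

variable {S D B : Finset ℕ} {x : ℕ} {P : Finset (Finset ℕ)}

theorem insert_open (hx : ∀ y ∈ S, x < y) (H : IsOpenConfig S P D) :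
    IsOpenConfig (insert x S) P (insert x D) where
  subset B hB := (H.subset B hB).trans (Finset.subset_insert _ _)
  nonempty := H.nonempty
  subset' := Finset.insert_subset_insert _ H.subset'
  eq_of_mem := H.eq_of_mem
  notMem := by
    intro B hB y hy
    have := hx y (H.subset B hB hy)
    have := H.notMem B hB y hy
    grind
  cover := by
    intro y hy
    have := H.cover y
    grind
  nonCrossing := H.nonCrossing
  outer := by
    intro B hB a ha c hc b hb hab hbc
    have := hx a (H.subset B hB ha)
    have := H.outer B hB a ha c hc b
    grind

theorem erase_open (hx : ∀ y ∈ S, x < y) (H : IsOpenConfig (insert x S) P D) (hxD : x ∈ D) :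
    IsOpenConfig S P (D.erase x) where
  subset := by
    intro B hB y hy
    have := H.subset B hB hy
    have := H.notMem B hB y hy
    grind
  nonempty := H.nonempty
  subset' := by
    intro y hy
    have := @H.subset' y
    grind
  eq_of_mem := H.eq_of_mem
  notMem := by
    intro B hB y hy
    have := H.notMem B hB y hy
    grind
  cover := by
    intro y hy
    have := H.cover y
    have := hx y hy
    grind
  nonCrossing := H.nonCrossing
  outer B hB a ha c hc b hb := H.outer B hB a ha c hc b (Finset.mem_of_mem_erase hb)

theorem lt_of_mem_block (hx : ∀ y ∈ S, x < y) (H : IsOpenConfig (insert x S) P D) (hB : B ∈ P)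
    (hxB : x ∈ B) {b y : ℕ} (hb : b ∈ B) (hy : y ∈ D) : b < y := by
  by_contra! hle
  have h1 := H.notMem B hB b hb
  have h2 := H.notMem B hB x hxB
  have h3 := H.subset' hy
  have h4 := H.outer B hB x hxB b hb y hy
  have h5 := hx y
  grind

theorem erase_block (hx : ∀ y ∈ S, x < y) (H : IsOpenConfig (insert x S) P D) (hB : B ∈ P)
    (hxB : x ∈ B) : IsOpenConfig S (P.erase B) (D ∪ B.erase x) where
  subset := by
    intro B' hB' y hy
    have := H.subset B' (Finset.mem_of_mem_erase hB') hy
    have := H.eq_of_mem B hB B' (Finset.mem_of_mem_erase hB') x hxB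
    grind
  nonempty B' hB' := H.nonempty B' (Finset.mem_of_mem_erase hB')
  subset' := by
    intro y hy
    have := @H.subset' y
    have := @H.subset B hB y
    have := H.notMem B hB x hxB
    grind
  eq_of_mem B' hB' B'' hB'' :=
    H.eq_of_mem B' (Finset.mem_of_mem_erase hB') B'' (Finset.mem_of_mem_erase hB'')
  notMem := by
    intro B' hB' y hy
    have := H.notMem B' (Finset.mem_of_mem_erase hB') y hy
    have := H.eq_of_mem B hB B' (Finset.mem_of_mem_erase hB') y
    grind
  cover := by
    intro y hy
    have := H.cover y (Finset.mem_insert_of_mem hy)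
    have := hx y hy
    grind
  nonCrossing B' hB' B'' hB'' :=
    H.nonCrossing B' (Finset.mem_of_mem_erase hB') B'' (Finset.mem_of_mem_erase hB'')
  outer := by
    intro B' hB' a ha c hc b hb hab hbc
    have hB'' := Finset.mem_of_mem_erase hB'
    have h1 := H.outer B' hB'' a ha c hc b
    have h2 := H.nonCrossing B hB B' hB'' (Finset.ne_of_mem_erase hB').symm x a b c
    have h3 := H.subset B' hB'' ha
    have h4 := H.eq_of_mem B hB B' hB'' x hxB
    have h5 := hx a
    grind

theorem insert_block (hx : ∀ y ∈ S, x < y) (H : IsOpenConfig S P D) (hBD : B ⊆ D)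
    (hlt : ∀ b ∈ B, ∀ y ∈ D \ B, b < y) :
    IsOpenConfig (insert x S) (insert (insert x B) P) (D \ B) where
  subset := by
    intro B' hB'
    have := H.subset'
    have := H.subset B'
    grind
  nonempty := by
    intro B' hB'
    rcases Finset.mem_insert.1 hB' with rfl | hB'
    · exact Finset.insert_nonempty _ _
    · exact H.nonempty B' hB'
  subset' := by
    intro y hy
    have := @H.subset' y
    grind
  eq_of_mem := by
    have key : ∀ B' ∈ P, ∀ y ∈ B', y ∉ insert x B := by
      intro B' hB' y hy
      have := H.notMem B' hB' y hy
      have := hx y (H.subset B' hB' hy)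
      grind
    intro B₁ h₁ B₂ h₂ y hy₁ hy₂
    have := H.eq_of_mem B₁
    have := key B₁
    have := key B₂
    grind
  notMem := by
    intro B' hB' y hy
    have := H.notMem B'
    have := hx x
    have := @H.subset' x
    grind
  cover := by
    intro y hy
    by_cases hyB : y ∈ insert x B
    · exact Or.inr ⟨_, Finset.mem_insert_self _ _, hyB⟩
    · have := H.cover y
      grind
  nonCrossing := by
    intro B₁ h₁ B₂ h₂ hne a b c d hab hbc hcd ha hc hb hd
    rw [Finset.mem_insert] at h₁ h₂
    rcases h₁ with rfl | h₁ <;> rcases h₂ with rfl | h₂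
    · exact hne rfl
    · have := H.outer B₂ h₂ b hb d hd c
      have := hx b (H.subset B₂ h₂ hb)
      grind
    · have := H.outer B₁ h₁ a ha c hc b
      have := hx a (H.subset B₁ h₁ ha)
      grind
    · exact H.nonCrossing B₁ h₁ B₂ h₂ hne a b c d hab hbc hcd ha hc hb hd
  outer := by
    intro B' hB' a ha c hc b hb hab hbc
    rw [Finset.mem_insert] at hB'
    rcases hB' with rfl | hB'
    · have := hlt c
      have := hx b (H.subset' (Finset.sdiff_subset hb))
      grind
    · exact H.outer B' hB' a ha c hc b (Finset.sdiff_subset hb) hab hbc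

end IsOpenConfig

theorem isOpenConfig_empty_iff {P : Finset (Finset ℕ)} {D : Finset ℕ} :
    IsOpenConfig ∅ P D ↔ P = ∅ ∧ D = ∅ := by
  constructor
  · intro H
    refine ⟨Finset.eq_empty_of_forall_notMem fun B hB => ?_, Finset.subset_empty.1 H.subset'⟩
    have := H.subset B hB
    have := H.nonempty B hB
    simp_all
  · rintro ⟨rfl, rfl⟩
    constructor <;> simp [IsNonCrossing]

theorem exists_initial_subset (s : Finset ℕ) {k : ℕ} (hk : k ≤ s.card) :
    ∃ t ⊆ s, t.card = k ∧ ∀ a ∈ t, ∀ b ∈ s \ t, a < b := by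
  induction s using Finset.induction_on_max with
  | empty => exact ⟨∅, by simp_all⟩
  | insert m s hm ih =>
    have hms : m ∉ s := fun h => lt_irrefl _ (hm m h)
    rcases hk.eq_or_lt with rfl | hlt
    · exact ⟨insert m s, by simp⟩
    · rw [Finset.card_insert_of_notMem hms, Nat.lt_succ_iff] at hlt
      obtain ⟨t, hts, htk, ht⟩ := ih hlt
      refine ⟨t, hts.trans (Finset.subset_insert _ _), htk, fun a ha b hb => ?_⟩
      have := hm a (hts ha)
      have := ht a ha b
      grind

theorem initial_subset_unique {s t t' : Finset ℕ} (ht : t ⊆ s) (ht' : t' ⊆ s)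
    (hcard : t.card = t'.card) (h : ∀ a ∈ t, ∀ b ∈ s \ t, a < b)
    (h' : ∀ a ∈ t', ∀ b ∈ s \ t', a < b) : t = t' := by
  by_cases hsub : t ⊆ t'
  · exact Finset.eq_of_subset_of_card_le hsub hcard.ge
  · refine (Finset.eq_of_subset_of_card_le (fun b hb => ?_) hcard.le).symm
    obtain ⟨a, ha, ha'⟩ := Finset.not_subset.1 hsub
    by_contra hbt
    exact lt_asymm (h a ha b (Finset.mem_sdiff.2 ⟨ht' hb, hbt⟩))
      (h' b hb a (Finset.mem_sdiff.2 ⟨ht ha, ha'⟩))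

/-- The finite set of open configurations on `S` with `d` open elements. -/
noncomputable def openConfigs (S : Finset ℕ) (d : ℕ) : Finset (Finset (Finset ℕ) × Finset ℕ) :=
  (S.powerset.powerset ×ˢ S.powerset).filter fun p => IsOpenConfig S p.1 p.2 ∧ p.2.card = d

theorem mem_openConfigs {S : Finset ℕ} {d : ℕ} {p : Finset (Finset ℕ) × Finset ℕ} :
    p ∈ openConfigs S d ↔ IsOpenConfig S p.1 p.2 ∧ p.2.card = d := by
  refine ⟨fun h => (Finset.mem_filter.1 h).2, fun h => Finset.mem_filter.2 ⟨?_, h⟩⟩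
  simp only [Finset.mem_product, Finset.mem_powerset]
  exact ⟨fun B hB => Finset.mem_powerset.2 (h.1.subset B hB), h.1.subset'⟩

/-- The weighted count of the words of length `n`, started at height `d`, that stay nonnegative
and end at `0`, where a letter `k` has weight `h k` (`1` if `k = 0`) and changes the height by
`k - 1`. -/
def wordWeight {R : Type*} [CommSemiring R] (h : ℕ → R) : ℕ → ℕ → R
  | 0, d => if d = 0 then 1 else 0
  | n + 1, d => (if d = 0 then 0 else wordWeight h n (d - 1)) +
      ∑ k ∈ Finset.range (n + 1), h (k + 1) * wordWeight h n (d + k)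

section Weights

variable {R : Type*} [CommSemiring R] (h : ℕ → R) {S : Finset ℕ} {x : ℕ}

theorem sum_openConfigs_of_mem (hx : ∀ y ∈ S, x < y) (d : ℕ) :
    ∑ p ∈ openConfigs (insert x S) d with x ∈ p.2, ∏ B ∈ p.1, h B.card =
      if d = 0 then 0 else ∑ p ∈ openConfigs S (d - 1), ∏ B ∈ p.1, h B.card := by
  have hxS : x ∉ S := fun h => lt_irrefl _ (hx x h)
  split_ifs with hd
  · subst hd
    refine Finset.sum_eq_zero fun p hp => ?_
    rw [Finset.mem_filter, mem_openConfigs, Finset.card_eq_zero] at hp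
    simp [hp.1.2] at hp
  · refine Finset.sum_nbij' (fun p => (p.1, p.2.erase x)) (fun p => (p.1, insert x p.2))
      ?_ ?_ ?_ ?_ ?_
    · intro p hp
      rw [Finset.mem_filter, mem_openConfigs] at hp
      rw [mem_openConfigs]
      exact ⟨hp.1.1.erase_open hx hp.2, by rw [Finset.card_erase_of_mem hp.2, hp.1.2]⟩
    · intro p hp
      rw [mem_openConfigs] at hp
      rw [Finset.mem_filter, mem_openConfigs]
      refine ⟨⟨hp.1.insert_open hx, ?_⟩, Finset.mem_insert_self _ _⟩
      rw [Finset.card_insert_of_notMem fun hh => hxS (hp.1.subset' hh), hp.2]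
      omega
    · intro p hp
      simp [Finset.insert_erase (Finset.mem_filter.1 hp).2]
    · intro p hp
      rw [mem_openConfigs] at hp
      simp [Finset.erase_insert fun hh => hxS (hp.1.subset' hh)]
    · intro p hp
      rfl

/-- The union of the blocks of `P` containing `x`. -/
noncomputable def blockAt (x : ℕ) (P : Finset (Finset ℕ)) : Finset ℕ :=
  (P.filter fun B => x ∈ B).biUnion id

theorem IsOpenConfig.blockAt_eq {P : Finset (Finset ℕ)} {D B : Finset ℕ}
    (H : IsOpenConfig S P D) (hB : B ∈ P) (hxB : x ∈ B) : blockAt x P = B := by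
  have : P.filter (fun B => x ∈ B) = {B} := by
    ext B'
    have := H.eq_of_mem B hB B'
    grind
  simp [blockAt, this]

theorem sum_openConfigs_of_card (hx : ∀ y ∈ S, x < y) (d k : ℕ) :
    ∑ p ∈ openConfigs (insert x S) d with x ∉ p.2 ∧ (blockAt x p.1).card = k + 1,
        ∏ B ∈ p.1, h B.card =
      h (k + 1) * ∑ p ∈ openConfigs S (d + k), ∏ B ∈ p.1, h B.card := by
  have hxS : x ∉ S := fun h => lt_irrefl _ (hx x h)
  have key : ∀ p ∈ (openConfigs (insert x S) d).filter
      (fun p => x ∉ p.2 ∧ (blockAt x p.1).card = k + 1), IsOpenConfig (insert x S) p.1 p.2 ∧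
      p.2.card = d ∧ blockAt x p.1 ∈ p.1 ∧ x ∈ blockAt x p.1 ∧
      (blockAt x p.1).card = k + 1 := by
    intro p hp
    rw [Finset.mem_filter, mem_openConfigs] at hp
    obtain ⟨B, hB, hxB⟩ := (hp.1.1.cover x (Finset.mem_insert_self _ _)).resolve_left hp.2.1
    have := hp.1.1.blockAt_eq hB hxB
    refine ⟨hp.1.1, hp.1.2, ?_, ?_, hp.2.2⟩ <;> rwa [this]
  have split : ∀ p ∈ (openConfigs (insert x S) d).filter
      (fun p => x ∉ p.2 ∧ (blockAt x p.1).card = k + 1),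
      (p.2 ∪ (blockAt x p.1).erase x) \ (blockAt x p.1).erase x = p.2 := by
    intro p hp
    obtain ⟨H, hd, hmem, hxm, hcard⟩ := key p hp
    have := H.notMem _ hmem
    grind
  rw [Finset.mul_sum]
  refine Finset.sum_bij
    (fun p _ => (p.1.erase (blockAt x p.1), p.2 ∪ (blockAt x p.1).erase x)) ?_ ?_ ?_ ?_
  · intro p hp
    obtain ⟨H, hd, hmem, hxm, hcard⟩ := key p hp
    rw [mem_openConfigs]
    refine ⟨H.erase_block hx hmem hxm, ?_⟩
    rw [Finset.card_union_of_disjoint, Finset.card_erase_of_mem hxm, hd, hcard, Nat.add_sub_cancel]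
    rw [Finset.disjoint_left]
    intro y hy hy'
    exact H.notMem _ hmem y (Finset.mem_of_mem_erase hy') hy
  · intro p hp q hq hpq
    obtain ⟨H, hd, hmem, hxm, hcard⟩ := key p hp
    obtain ⟨H', hd', hmem', hxm', hcard'⟩ := key q hq
    simp only [Prod.mk.injEq] at hpq
    have heq : (blockAt x p.1).erase x = (blockAt x q.1).erase x := by
      refine initial_subset_unique (s := p.2 ∪ (blockAt x p.1).erase x)
        Finset.subset_union_right (hpq.2 ▸ Finset.subset_union_right) ?_ ?_ ?_
      · rw [Finset.card_erase_of_mem hxm, Finset.card_erase_of_mem hxm', hcard, hcard']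
      · rw [split p hp]
        exact fun a ha b hb => H.lt_of_mem_block hx hmem hxm (Finset.mem_of_mem_erase ha) hb
      · rw [hpq.2, split q hq]
        exact fun a ha b hb => H'.lt_of_mem_block hx hmem' hxm' (Finset.mem_of_mem_erase ha) hb
    have hblock : blockAt x p.1 = blockAt x q.1 := by
      rw [← Finset.insert_erase hxm, heq, Finset.insert_erase hxm']
    refine Prod.ext ?_ ?_
    · rw [← Finset.insert_erase hmem, hpq.1, hblock, Finset.insert_erase hmem']
    · rw [← split p hp, ← split q hq, hpq.2, heq]
  · intro q hq
    rw [mem_openConfigs] at hq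
    obtain ⟨H, hcard⟩ := hq
    obtain ⟨B, hBD, hBk, hlt⟩ := exists_initial_subset q.2 (k := k) (by omega)
    have hxB : x ∉ B := fun hh => hxS (H.subset' (hBD hh))
    have H' := H.insert_block hx hBD hlt
    have hblock : blockAt x (insert (insert x B) q.1) = insert x B :=
      H'.blockAt_eq (Finset.mem_insert_self _ _) (Finset.mem_insert_self _ _)
    have hnot : insert x B ∉ q.1 := fun hh =>
      hxS (H.subset _ hh (Finset.mem_insert_self _ _))
    refine ⟨(insert (insert x B) q.1, q.2 \ B), ?_, ?_⟩
    · rw [Finset.mem_filter, mem_openConfigs]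
      refine ⟨⟨H', ?_⟩, ?_, ?_⟩
      · rw [Finset.card_sdiff_of_subset hBD]
        omega
      · exact fun hh => hxS (H.subset' (Finset.sdiff_subset hh))
      · rw [hblock, Finset.card_insert_of_notMem hxB, hBk]
    · simp only [hblock, Finset.erase_insert hnot, Finset.erase_insert hxB,
        Finset.sdiff_union_of_subset hBD]
  · intro p hp
    obtain ⟨H, hd, hmem, hxm, hcard⟩ := key p hp
    rw [← hcard, Finset.mul_prod_erase _ (fun B => h B.card) hmem]

theorem sum_openConfigs (S : Finset ℕ) (d : ℕ) :
    ∑ p ∈ openConfigs S d, ∏ B ∈ p.1, h B.card = wordWeight h S.card d := by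
  induction S using Finset.induction_on_min generalizing d with
  | empty =>
    rw [Finset.card_empty, wordWeight]
    split_ifs with hd
    · have : openConfigs ∅ d = {(∅, ∅)} := by
        ext p
        rw [mem_openConfigs, isOpenConfig_empty_iff, Finset.mem_singleton, Prod.ext_iff]
        simp only [hd, Finset.card_eq_zero]
        tauto
      simp [this]
    · have : openConfigs ∅ d = ∅ := by
        refine Finset.eq_empty_of_forall_notMem fun p hp => ?_
        rw [mem_openConfigs, isOpenConfig_empty_iff] at hp
        exact hd (by rw [← hp.2, hp.1.2, Finset.card_empty])
      simp [this]
  | insert x S hx ih =>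
    have hxS : x ∉ S := fun h => lt_irrefl _ (hx x h)
    rw [Finset.card_insert_of_notMem hxS, wordWeight,
      ← Finset.sum_filter_add_sum_filter_not _ (fun p => x ∈ p.2), sum_openConfigs_of_mem h hx]
    congr 1
    · rw [ih]
    · rw [← Finset.sum_fiberwise_of_maps_to (t := Finset.range (S.card + 1))
        (g := fun p => (blockAt x p.1).card - 1)]
      · refine Finset.sum_congr rfl fun k _ => ?_
        rw [← ih, ← sum_openConfigs_of_card h hx, Finset.filter_filter]
        refine Finset.sum_congr (Finset.filter_congr fun p hp => ?_) fun _ _ => rfl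
        refine and_congr_right fun hxp => ?_
        rw [mem_openConfigs] at hp
        obtain ⟨B, hB, hxB⟩ := (hp.1.cover x (Finset.mem_insert_self _ _)).resolve_left hxp
        have := Finset.card_pos.2 ⟨x, hxB⟩
        rw [hp.1.blockAt_eq hB hxB]
        omega
      · intro p hp
        rw [Finset.mem_filter, mem_openConfigs] at hp
        obtain ⟨B, hB, hxB⟩ := (hp.1.1.cover x (Finset.mem_insert_self _ _)).resolve_left hp.2
        have := Finset.card_le_card (hp.1.1.subset B hB)
        rw [Finset.card_insert_of_notMem hxS] at this
        rw [hp.1.1.blockAt_eq hB hxB, Finset.mem_range]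
        omega

end Weights

theorem isOpenConfig_iff_isPartitionOf {n : ℕ} {P : Finset (Finset ℕ)} :
    IsOpenConfig (Finset.Icc 1 n) P ∅ ↔ IsPartitionOf n P ∧ IsNonCrossing P := by
  constructor
  · intro H
    refine ⟨⟨fun B hB => ⟨H.subset B hB, H.nonempty B hB⟩, fun x hx => ?_⟩, H.nonCrossing⟩
    obtain ⟨B, hB, hxB⟩ := (H.cover x hx).resolve_left (Finset.notMem_empty x)
    exact ⟨B, ⟨hB, hxB⟩, fun B' hB' => H.eq_of_mem B' hB'.1 B hB x hB'.2 hxB⟩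
  · rintro ⟨⟨h1, h2⟩, h3⟩
    refine ⟨fun B hB => (h1 B hB).1, fun B hB => (h1 B hB).2, by simp, ?_, by simp, ?_, h3,
      by simp⟩
    · exact fun B hB B' hB' x hx hx' =>
        (h2 x ((h1 B hB).1 hx)).unique ⟨hB, hx⟩ ⟨hB', hx'⟩
    · intro x hx
      obtain ⟨B, hB, -⟩ := h2 x hx
      exact Or.inr ⟨B, hB⟩

theorem mem_NCP {n : ℕ} {P : Finset (Finset ℕ)} :
    P ∈ NCP n ↔ IsPartitionOf n P ∧ IsNonCrossing P := by
  refine ⟨fun h => (Finset.mem_filter.1 h).2, fun h => Finset.mem_filter.2 ⟨?_, h⟩⟩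
  exact Finset.mem_powerset.2 fun B hB => Finset.mem_powerset.2 (h.1.1 B hB).1

theorem sum_NCP {R : Type*} [CommSemiring R] (h : ℕ → R) (n : ℕ) :
    ∑ P ∈ NCP n, ∏ B ∈ P, h B.card = wordWeight h n 0 := by
  have := sum_openConfigs h (Finset.Icc 1 n) 0
  rw [Nat.card_Icc, Nat.add_sub_cancel] at this
  rw [← this]
  refine Finset.sum_nbij' (fun P => (P, ∅)) Prod.fst ?_ ?_ ?_ ?_ ?_
  · intro P hP
    rw [mem_openConfigs]
    exact ⟨isOpenConfig_iff_isPartitionOf.2 (mem_NCP.1 hP), rfl⟩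
  · rintro ⟨P, D⟩ hp
    rw [mem_openConfigs, Finset.card_eq_zero] at hp
    obtain ⟨H, rfl⟩ := hp
    exact mem_NCP.2 (isOpenConfig_iff_isPartitionOf.1 H)
  · exact fun _ _ => rfl
  · rintro ⟨P, D⟩ hp
    rw [mem_openConfigs, Finset.card_eq_zero] at hp
    exact Prod.ext rfl hp.2.symm
  · exact fun _ _ => rfl

/-- Weighted counting of the partitions in `NCPA A n` through block weights. -/
theorem sum_NCPA {R : Type*} [CommSemiring R] (A : Set ℕ) (h : ℕ → R) (n : ℕ) :
    ∑ P ∈ NCPA A n, ∏ B ∈ P, h B.card =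
      wordWeight (fun k => if k ∈ A then h k else 0) n 0 := by
  rw [← sum_NCP, NCPA, Finset.sum_filter]
  refine Finset.sum_congr rfl fun P _ => ?_
  split_ifs with hP
  · exact Finset.prod_congr rfl fun B hB => by rw [if_pos (hP B hB)]
  · push Not at hP
    obtain ⟨B, hB, hBA⟩ := hP
    exact (Finset.prod_eq_zero hB (by rw [if_neg hBA])).symm

theorem card_NCPA {R : Type*} [CommSemiring R] (A : Set ℕ) (n : ℕ) :
    ((NCPA A n).card : R) = wordWeight (fun k => if k ∈ A then 1 else 0) n 0 := by
  simpa using sum_NCPA A (fun _ => (1 : R)) n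

section WordWeight

variable {R : Type*} [CommSemiring R] (h : ℕ → R)

theorem wordWeight_eq_zero_of_lt {n d : ℕ} (hnd : n < d) : wordWeight h n d = 0 := by
  induction n generalizing d with
  | zero => simp [wordWeight, hnd.ne']
  | succ n ih =>
    rw [wordWeight, if_neg (by omega), ih (by omega), zero_add]
    exact Finset.sum_eq_zero fun k _ => by rw [ih (by omega), mul_zero]

theorem wordWeight_succ_of_le {n N : ℕ} (hn : n ≤ N) (d : ℕ) :
    wordWeight h (n + 1) d = (if d = 0 then 0 else wordWeight h n (d - 1)) +
      ∑ k ∈ Finset.range (N + 1), h (k + 1) * wordWeight h n (d + k) := by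
  rw [wordWeight]
  congr 1
  refine Finset.sum_subset (Finset.range_mono (by omega)) fun k _ hk => ?_
  rw [wordWeight_eq_zero_of_lt h, mul_zero]
  rw [Finset.mem_range] at hk
  omega

/-- Convolution identity: a path starting at height `c + d + 1` splits at its first visit
to `d`. -/
theorem sum_antidiagonal_wordWeight (n c d : ℕ) :
    ∑ ij ∈ Finset.HasAntidiagonal.antidiagonal n, wordWeight h ij.1 c * wordWeight h ij.2 d =
      wordWeight h (n + 1) (c + d + 1) := by
  induction n generalizing c with
  | zero =>
    simp [wordWeight, ← ite_and, and_comm]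
  | succ n ih =>
    have hrec : ∀ ij ∈ Finset.HasAntidiagonal.antidiagonal n,
        wordWeight h (ij.1 + 1) c * wordWeight h ij.2 d =
          (if c = 0 then 0 else wordWeight h ij.1 (c - 1) * wordWeight h ij.2 d) +
          ∑ k ∈ Finset.range (n + 1 + 1),
            h (k + 1) * (wordWeight h ij.1 (c + k) * wordWeight h ij.2 d) := by
      intro ij hij
      rw [Finset.HasAntidiagonal.mem_antidiagonal] at hij
      rw [wordWeight_succ_of_le h (N := n + 1) (by omega), add_mul, ite_mul, zero_mul,
        Finset.sum_mul]
      simp only [mul_assoc]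
    rw [Finset.Nat.sum_antidiagonal_succ, Finset.sum_congr rfl hrec, Finset.sum_add_distrib,
      Finset.sum_comm, wordWeight_succ_of_le h (le_refl (n + 1)), if_neg (by omega), ← add_assoc]
    congr 1
    · rcases Nat.eq_zero_or_pos c with rfl | hc
      · simp [wordWeight]
      · rw [wordWeight_eq_zero_of_lt h hc, zero_mul, zero_add]
        simp only [hc.ne', if_false]
        rw [ih]
        congr 1
        omega
    · refine Finset.sum_congr rfl fun k _ => ?_
      rw [← Finset.mul_sum, ih]
      congr 2
      omega

end WordWeight

theorem wordWeight_mul_le (h : ℕ → ℕ) (m n c d : ℕ) :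
    wordWeight h m c * wordWeight h n d ≤ wordWeight h (m + n) (c + d) := by
  induction m generalizing c with
  | zero =>
    rw [wordWeight]
    split_ifs with hc
    · simp [hc]
    · simp
  | succ m ih =>
    rw [wordWeight, Nat.succ_add, wordWeight_succ_of_le h le_rfl, add_mul, ite_mul, zero_mul,
      Finset.sum_mul]
    refine add_le_add ?_ ?_
    · split_ifs with h1 h2
      · exact Nat.zero_le _
      · exact Nat.zero_le _
      · omega
      · refine (ih (c - 1)).trans (le_of_eq ?_)
        congr 1
        omega
    · refine (Finset.sum_le_sum fun k _ => ?_).trans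
        (Finset.sum_le_sum_of_subset (Finset.range_mono (by omega : m + 1 ≤ m + n + 1)))
      rw [mul_assoc, Nat.add_right_comm c d k]
      exact Nat.mul_le_mul_left _ (ih _)

theorem card_NCPA_mul_le (A : Set ℕ) (m n : ℕ) :
    (NCPA A m).card * (NCPA A n).card ≤ (NCPA A (m + n)).card := by
  have key : ∀ n, (NCPA A n).card = wordWeight (fun k => if k ∈ A then 1 else 0) n 0 :=
    fun n => by simpa using card_NCPA (R := ℕ) A n
  simpa only [key] using wordWeight_mul_le (fun k => if k ∈ A then 1 else 0) m n 0 0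

theorem wordWeight_mul_pow_le {h : ℕ → ℝ} (h0 : ∀ k, 0 ≤ h k) {ξ G : ℝ} (hξ : 0 ≤ ξ)
    (hG : ∀ N, 1 + ∑ k ∈ Finset.range N, h (k + 1) * ξ ^ (k + 1) ≤ G) (n d : ℕ) :
    wordWeight h n d * ξ ^ n ≤ ξ ^ d * G ^ n := by
  have hG0 : 0 ≤ G := by
    have := hG 0
    simp only [Finset.range_zero, Finset.sum_empty] at this
    linarith
  induction n generalizing d with
  | zero =>
    rw [wordWeight]
    split_ifs with hd
    · simp [hd]
    · rw [zero_mul]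
      positivity
  | succ n ih =>
    rw [wordWeight, add_mul, Finset.sum_mul]
    have h1 : (if d = 0 then 0 else wordWeight h n (d - 1)) * ξ ^ (n + 1) ≤ ξ ^ d * G ^ n := by
      split_ifs with hd
      · rw [zero_mul]; positivity
      · obtain ⟨d, rfl⟩ := Nat.exists_eq_succ_of_ne_zero hd
        calc _ = ξ * (wordWeight h n d * ξ ^ n) := by simp only [Nat.succ_sub_one]; ring
          _ ≤ ξ * (ξ ^ d * G ^ n) := mul_le_mul_of_nonneg_left (ih d) hξ
          _ = _ := by rw [Nat.succ_eq_add_one]; ring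
    have h2 : ∀ k ∈ Finset.range (n + 1), h (k + 1) * wordWeight h n (d + k) * ξ ^ (n + 1) ≤
        ξ ^ d * G ^ n * (h (k + 1) * ξ ^ (k + 1)) := by
      intro k _
      calc _ = h (k + 1) * ξ * (wordWeight h n (d + k) * ξ ^ n) := by ring
        _ ≤ h (k + 1) * ξ * (ξ ^ (d + k) * G ^ n) := by
          exact mul_le_mul_of_nonneg_left (ih _) (mul_nonneg (h0 _) hξ)
        _ = _ := by ring
    calc _ ≤ ξ ^ d * G ^ n + ∑ k ∈ Finset.range (n + 1),
          ξ ^ d * G ^ n * (h (k + 1) * ξ ^ (k + 1)) := add_le_add h1 (Finset.sum_le_sum h2)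
      _ = ξ ^ d * G ^ n * (1 + ∑ k ∈ Finset.range (n + 1), h (k + 1) * ξ ^ (k + 1)) := by
        rw [← Finset.mul_sum]; ring
      _ ≤ ξ ^ d * G ^ n * G := by gcongr; exact hG _
      _ = _ := by ring

open scoped ENNReal in
theorem tsum_wordWeight_mul_le (h : ℕ → ℝ≥0∞) (z : ℝ≥0∞) (c : ℕ) :
    z * ((∑' n, wordWeight h n c * z ^ n) * ∑' n, wordWeight h n 0 * z ^ n) ≤
      ∑' n, wordWeight h n (c + 1) * z ^ n := by
  calc _ = z * ∑' p : ℕ × ℕ,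
        (wordWeight h p.1 c * z ^ p.1) * (wordWeight h p.2 0 * z ^ p.2) := by
        rw [ENNReal.tsum_prod', ← ENNReal.tsum_mul_right]
        simp_rw [ENNReal.tsum_mul_left]
    _ = z * ∑' n, ∑ ij ∈ Finset.HasAntidiagonal.antidiagonal n,
        (wordWeight h ij.1 c * z ^ ij.1) * (wordWeight h ij.2 0 * z ^ ij.2) := by
        rw [← Finset.HasAntidiagonal.sigmaAntidiagonalEquivProd.tsum_eq, ENNReal.tsum_sigma']
        congr 1
        refine tsum_congr fun n => ?_
        rw [tsum_fintype]
        exact Finset.sum_coe_sort (Finset.HasAntidiagonal.antidiagonal n) fun p =>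
          (wordWeight h p.1 c * z ^ p.1) * (wordWeight h p.2 0 * z ^ p.2)
    _ = ∑' n, wordWeight h (n + 1) (c + 1) * z ^ (n + 1) := by
        rw [← ENNReal.tsum_mul_left]
        refine tsum_congr fun n => ?_
        have := sum_antidiagonal_wordWeight h n c 0
        rw [add_zero] at this
        rw [← this, Finset.sum_mul, Finset.mul_sum]
        refine Finset.sum_congr rfl fun ij hij => ?_
        rw [← Finset.HasAntidiagonal.mem_antidiagonal.1 hij]
        ring
    _ ≤ _ := ENNReal.tsum_comp_le_tsum_of_injective (add_left_injective 1)
        (fun n => wordWeight h n (c + 1) * z ^ n)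

open scoped ENNReal in
/-- The generating function `F` of the words from `0` to `0` satisfies
`1 + ∑ h(k) (z F)^k ≤ F`. -/
theorem one_add_sum_le_tsum_wordWeight (h : ℕ → ℝ≥0∞) (z : ℝ≥0∞) (N : ℕ) :
    1 + ∑ k ∈ Finset.range N, h (k + 1) * (z * ∑' n, wordWeight h n 0 * z ^ n) ^ (k + 1) ≤
      ∑' n, wordWeight h n 0 * z ^ n := by
  set E : ℕ → ℝ≥0∞ := fun c => ∑' n, wordWeight h n c * z ^ n with hE
  change 1 + ∑ k ∈ Finset.range N, h (k + 1) * (z * E 0) ^ (k + 1) ≤ E 0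
  have hpow : ∀ k, (z * E 0) ^ (k + 1) ≤ z * E k := by
    intro k
    induction k with
    | zero => simp
    | succ k ih =>
      calc (z * E 0) ^ (k + 1 + 1) ≤ z * E k * (z * E 0) := by rw [pow_succ]; gcongr
        _ = z * (z * (E k * E 0)) := by ring
        _ ≤ _ := by gcongr; exact tsum_wordWeight_mul_le h z k
  have hfirst : E 0 = 1 + ∑' n, wordWeight h (n + 1) 0 * z ^ (n + 1) := by
    rw [hE]
    dsimp only
    rw [tsum_eq_zero_add' ENNReal.summable]
    simp [wordWeight]
  rw [hfirst]
  gcongr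
  rw [← hfirst]
  calc ∑ k ∈ Finset.range N, h (k + 1) * (z * E 0) ^ (k + 1)
      ≤ ∑' k, h (k + 1) * (z * E 0) ^ (k + 1) := ENNReal.sum_le_tsum _
    _ ≤ ∑' k, ∑' n, h (k + 1) * wordWeight h n k * z ^ (n + 1) := by
        refine ENNReal.tsum_le_tsum fun k => ?_
        calc _ ≤ h (k + 1) * (z * E k) := by gcongr; exact hpow k
          _ = _ := by
            rw [hE, ← ENNReal.tsum_mul_left, ← ENNReal.tsum_mul_left]
            exact tsum_congr fun n => by ring
    _ = ∑' n, ∑' k, h (k + 1) * wordWeight h n k * z ^ (n + 1) := ENNReal.tsum_comm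
    _ = _ := by
        refine tsum_congr fun n => ?_
        rw [tsum_eq_sum (s := Finset.range (n + 1)), wordWeight, if_pos rfl, zero_add,
          Finset.sum_mul]
        · simp
        · intro k hk
          rw [wordWeight_eq_zero_of_lt h, mul_zero, zero_mul]
          simpa using hk

section Growth

variable {A : Set ℕ} {ξ Z : ℝ}

theorem sum_range_indicator_succ (hA : 0 ∉ A) (f : ℕ → ℝ) (N : ℕ) :
    ∑ k ∈ Finset.range (N + 1), A.indicator f k =
      ∑ k ∈ Finset.range N, A.indicator f (k + 1) := by
  rw [Finset.sum_range_succ', Set.indicator_of_notMem hA, add_zero]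

/-- The minimum of `(1 + ∑_{a ∈ A} v ^ a) / v` over `v > 0` is attained at `v = ξ`. -/
theorem mul_div_le_of_forall_sum_le (hA : 0 ∉ A) (hξ : 0 < ξ)
    (hZ : HasSum (A.indicator fun k => ξ ^ k) (Z - 1))
    (hZ' : HasSum (A.indicator fun k => (k : ℝ) * ξ ^ k) Z) {v f : ℝ} (hv : 0 ≤ v)
    (hf : ∀ N, 1 + ∑ k ∈ Finset.range N, A.indicator (fun k => v ^ k) (k + 1) ≤ f) :
    Z * v / ξ ≤ f := by
  have hsum := hZ.add (hZ'.mul_right (v / ξ - 1))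
  have hle : ∀ k, A.indicator (fun k => ξ ^ k) k +
      A.indicator (fun k => (k : ℝ) * ξ ^ k) k * (v / ξ - 1) ≤ A.indicator (fun k => v ^ k) k := by
    intro k
    by_cases hk : k ∈ A
    · simp only [Set.indicator_of_mem hk]
      have h1 : -2 ≤ v / ξ - 1 := by
        have : 0 ≤ v / ξ := by positivity
        linarith
      have h2 := one_add_mul_le_pow h1 k
      calc ξ ^ k + k * ξ ^ k * (v / ξ - 1) = (1 + k * (v / ξ - 1)) * ξ ^ k := by ring
        _ ≤ (1 + (v / ξ - 1)) ^ k * ξ ^ k := by gcongr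
        _ = v ^ k := by rw [← mul_pow, add_sub_cancel, div_mul_cancel₀ _ hξ.ne']
    · simp [Set.indicator_of_notMem hk]
  have hlim : Z - 1 + Z * (v / ξ - 1) ≤ f - 1 := by
    refine le_of_tendsto' (hsum.tendsto_sum_nat.comp (Filter.tendsto_add_atTop_nat 1)) fun N => ?_
    refine (Finset.sum_le_sum fun k _ => hle k).trans ?_
    rw [sum_range_indicator_succ hA]
    linarith [hf N]
  have : Z * v / ξ = Z * (v / ξ) := mul_div_assoc _ _ _
  linarith

open scoped ENNReal in
theorem tsum_card_NCPA_eq_top (hA : 0 ∉ A) (hξ : 0 < ξ)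
    (hZ : HasSum (A.indicator fun k => ξ ^ k) (Z - 1))
    (hZ' : HasSum (A.indicator fun k => (k : ℝ) * ξ ^ k) Z) {z : ℝ} (hz : 0 < z)
    (hzZ : ξ < Z * z) :
    ∑' n, ((NCPA A n).card : ℝ≥0∞) * ENNReal.ofReal z ^ n = ⊤ := by
  by_contra hF
  have key := one_add_sum_le_tsum_wordWeight
    (fun k => if k ∈ A then (1 : ℝ≥0∞) else 0) (ENNReal.ofReal z)
  simp only [← card_NCPA] at key
  set F := ∑' n, ((NCPA A n).card : ℝ≥0∞) * ENNReal.ofReal z ^ n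
  obtain ⟨f, hf0, hf⟩ : ∃ f : ℝ, 0 ≤ f ∧ F = ENNReal.ofReal f :=
    ⟨F.toReal, ENNReal.toReal_nonneg, (ENNReal.ofReal_toReal hF).symm⟩
  have hle : ∀ N, 1 + ∑ k ∈ Finset.range N, A.indicator (fun k => (z * f) ^ k) (k + 1) ≤ f := by
    intro N
    have hnn : ∀ k, 0 ≤ A.indicator (fun k => (z * f) ^ k) k :=
      fun k => Set.indicator_nonneg (fun _ _ => by positivity) k
    rw [← ENNReal.ofReal_le_ofReal_iff hf0, ENNReal.ofReal_add zero_le_one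
      (Finset.sum_nonneg fun k _ => hnn _), ENNReal.ofReal_one,
      ENNReal.ofReal_sum_of_nonneg fun k _ => hnn _, ← hf]
    refine (le_of_eq ?_).trans (key N)
    congr 1
    refine Finset.sum_congr rfl fun k _ => ?_
    by_cases hk : k + 1 ∈ A
    · rw [Set.indicator_of_mem hk, if_pos hk, one_mul, hf, ← ENNReal.ofReal_mul hz.le,
        ENNReal.ofReal_pow (by positivity)]
    · simp [hk]
  have h1 := mul_div_le_of_forall_sum_le hA hξ hZ hZ' (by positivity) hle
  have h2 : 1 ≤ f := by simpa using hle 0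
  rw [div_le_iff₀ hξ] at h1
  nlinarith

theorem exists_pow_le_card_NCPA (hA : 0 ∉ A) (hξ : 0 < ξ)
    (hZ : HasSum (A.indicator fun k => ξ ^ k) (Z - 1))
    (hZ' : HasSum (A.indicator fun k => (k : ℝ) * ξ ^ k) Z) {q : ℝ} (hq : 0 < q)
    (hqZ : q * ξ < Z) : ∃ m, 0 < m ∧ q ^ m ≤ (NCPA A m).card := by
  by_contra! hlt
  obtain ⟨r, hqr, hrZ⟩ : ∃ r, q < r ∧ r * ξ < Z := by
    obtain ⟨r, h1, h2⟩ := exists_between ((lt_div_iff₀ hξ).2 hqZ)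
    exact ⟨r, h1, (lt_div_iff₀ hξ).1 h2⟩
  have hr : 0 < r := hq.trans hqr
  have htop := tsum_card_NCPA_eq_top hA hξ hZ hZ' (z := r⁻¹) (by positivity) (by
    rw [← div_eq_mul_inv, lt_div_iff₀ hr]
    linarith)
  have hsum : Summable fun n : ℕ => ((NCPA A n).card : ℝ) * r⁻¹ ^ n := by
    rw [← summable_nat_add_iff 1]
    refine Summable.of_nonneg_of_le (fun n => by positivity) (fun n => ?_)
      ((summable_nat_add_iff 1).2 (summable_geometric_of_lt_one (r := q * r⁻¹) (by positivity)
        (by rw [← div_eq_mul_inv, div_lt_one hr]; exact hqr)))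
    rw [mul_pow]
    gcongr
    exact (hlt (n + 1) n.succ_pos).le
  refine ENNReal.ofReal_ne_top ((ENNReal.ofReal_tsum_of_nonneg (fun n => by positivity) hsum).trans
    ((tsum_congr fun n => ?_).trans htop))
  rw [ENNReal.ofReal_mul (by positivity), ENNReal.ofReal_pow (by positivity),
    ENNReal.ofReal_natCast]

theorem card_NCPA_pow_mul_le (A : Set ℕ) (m n t : ℕ) :
    (NCPA A m).card ^ t * (NCPA A n).card ≤ (NCPA A (n + m * t)).card := by
  induction t with
  | zero => simp
  | succ t ih =>
    calc _ = (NCPA A m).card ^ t * (NCPA A n).card * (NCPA A m).card := by ring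
      _ ≤ (NCPA A (n + m * t)).card * (NCPA A m).card := Nat.mul_le_mul_right _ ih
      _ ≤ _ := card_NCPA_mul_le A _ _
      _ = _ := by rw [mul_add, mul_one, add_assoc]

/-- Exponential lower bound for the cardinality of `NCPA A n`, up to a subexponential factor. -/
theorem exists_mul_pow_le_card_NCPA (hA : 0 ∉ A) (hξ : 0 < ξ)
    (hZ : HasSum (A.indicator fun k => ξ ^ k) (Z - 1))
    (hZ' : HasSum (A.indicator fun k => (k : ℝ) * ξ ^ k) Z) {q : ℝ} (hq : 0 < q)
    (hqZ : q * ξ < Z) :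
    ∃ κ : ℝ, 0 < κ ∧ ∀ n, (NCPA A n).Nonempty → κ * q ^ n ≤ (NCPA A n).card := by
  obtain ⟨m, hm, hqm⟩ := exists_pow_le_card_NCPA hA hξ hZ hZ' hq hqZ
  have hres : ∀ r, ∃ κ : ℝ, 0 < κ ∧
      ∀ n, n % m = r → (NCPA A n).Nonempty → κ * q ^ n ≤ (NCPA A n).card := by
    intro r
    by_cases hex : ∃ n, n % m = r ∧ (NCPA A n).Nonempty
    · obtain ⟨n₀, ⟨h1, h2⟩, hmin⟩ : ∃ n₀, (n₀ % m = r ∧ (NCPA A n₀).Nonempty) ∧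
          ∀ n, n % m = r ∧ (NCPA A n).Nonempty → n₀ ≤ n :=
        ⟨Nat.find hex, Nat.find_spec hex, fun _ => Nat.find_min' hex⟩
      have hpos : 0 < ((NCPA A n₀).card : ℝ) := by exact_mod_cast h2.card_pos
      refine ⟨(NCPA A n₀).card / q ^ n₀, by positivity, fun n hn hne => ?_⟩
      obtain ⟨t, ht⟩ : ∃ t, n = n₀ + m * t := by
        obtain ⟨t, ht⟩ := (Nat.modEq_iff_dvd' (hmin n ⟨hn, hne⟩)).1 (h1.trans hn.symm)
        exact ⟨t, by have := hmin n ⟨hn, hne⟩; omega⟩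
      calc (NCPA A n₀).card / q ^ n₀ * q ^ n = (q ^ m) ^ t * (NCPA A n₀).card := by
            have : q ^ n₀ ≠ 0 := by positivity
            rw [ht, pow_add, pow_mul, ← mul_assoc, div_mul_cancel₀ _ this, mul_comm]
        _ ≤ ((NCPA A m).card : ℝ) ^ t * (NCPA A n₀).card := by gcongr
        _ ≤ (NCPA A n).card := by
            rw [ht]
            exact_mod_cast card_NCPA_pow_mul_le A m n₀ t
    · exact ⟨1, one_pos, fun n hn hne => (hex ⟨n, hn, hne⟩).elim⟩
  choose κ hκ hκle using hres
  obtain ⟨r₀, -, hr₀⟩ := Finset.exists_min_image (Finset.range m) κ ⟨0, Finset.mem_range.2 hm⟩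
  refine ⟨κ r₀, hκ r₀, fun n hne => le_trans ?_ (hκle (n % m) n rfl hne)⟩
  have := hr₀ (n % m) (Finset.mem_range.2 (Nat.mod_lt n hm))
  gcongr

end Growth

section Concentration

variable {A C : Set ℕ} {ξ Z p : ℝ}

theorem sum_exp_le (hA : 0 ∉ A) (hξ : 0 < ξ)
    (hZ : HasSum (A.indicator fun k => ξ ^ k) (Z - 1))
    (hp : HasSum ((A ∩ C).indicator fun k => ξ ^ k) (p * Z)) (n : ℕ) (s : ℝ) :
    (∑ P ∈ NCPA A n, Real.exp (s * (P.filter fun B => B.card ∈ C).card)) * ξ ^ n ≤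
      (Z * (1 + p * (Real.exp s - 1))) ^ n := by
  have hprod : ∀ P : Finset (Finset ℕ), Real.exp (s * (P.filter fun B => B.card ∈ C).card) =
      ∏ B ∈ P, if B.card ∈ C then Real.exp s else 1 := by
    intro P
    rw [Finset.prod_ite, Finset.prod_const, Finset.prod_const_one, mul_one, ← Real.exp_nat_mul,
      mul_comm]
  simp only [hprod]
  rw [sum_NCPA A fun k => if k ∈ C then Real.exp s else 1]
  have hG := hZ.add (hp.mul_right (Real.exp s - 1))
  have hterm : ∀ k, (if k ∈ A then if k ∈ C then Real.exp s else 1 else 0) * ξ ^ k =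
      A.indicator (fun k => ξ ^ k) k +
        (A ∩ C).indicator (fun k => ξ ^ k) k * (Real.exp s - 1) := by
    intro k
    by_cases hkA : k ∈ A <;> by_cases hkC : k ∈ C <;> simp [hkA, hkC]
    ring
  have hnn : ∀ k, 0 ≤ (if k ∈ A then if k ∈ C then Real.exp s else 1 else 0) := by
    intro k
    split_ifs <;> positivity
  have := wordWeight_mul_pow_le hnn hξ.le (G := Z * (1 + p * (Real.exp s - 1))) (fun N => ?_) n 0
  · simpa using this
  · have h0 : (if 0 ∈ A then if 0 ∈ C then Real.exp s else 1 else 0) * ξ ^ 0 = 0 := by simp [hA]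
    have h1 := sum_le_hasSum (Finset.range (N + 1)) (fun k _ => by
      rw [← hterm]; exact mul_nonneg (hnn k) (by positivity)) hG
    simp only [← hterm] at h1
    rw [Finset.sum_range_succ', h0] at h1
    linarith

theorem sum_exp_deviation_le (hA : 0 ∉ A) (hξ : 0 < ξ)
    (hZ : HasSum (A.indicator fun k => ξ ^ k) (Z - 1))
    (hp : HasSum ((A ∩ C).indicator fun k => ξ ^ k) (p * Z)) (hZ0 : 0 ≤ Z) (hp0 : 0 ≤ p)
    (hp1 : p ≤ 1) (n : ℕ) {s : ℝ} (hs : |s| ≤ 1) (δ : ℝ) :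
    (∑ P ∈ NCPA A n,
      Real.exp (s * ((P.filter fun B => B.card ∈ C).card - p * n) - δ * n)) * ξ ^ n ≤
      (Z * Real.exp (s ^ 2 - δ)) ^ n := by
  have hfactor : ∀ x : ℝ, Real.exp (s * (x - p * n) - δ * n) =
      Real.exp (s * x) * Real.exp (-(s * p) - δ) ^ n := by
    intro x
    rw [← Real.exp_nat_mul, ← Real.exp_add]
    ring_nf
  simp only [hfactor]
  rw [← Finset.sum_mul, mul_right_comm]
  have hquad : p * (Real.exp s - 1) ≤ s * p + s ^ 2 := by
    have h1 := (abs_le.1 (Real.abs_exp_sub_one_sub_id_le hs)).2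
    nlinarith [sq_nonneg s]
  have hbase : 0 ≤ 1 + p * (Real.exp s - 1) := by
    nlinarith [Real.exp_pos s]
  calc _ ≤ (Z * (1 + p * (Real.exp s - 1))) ^ n * Real.exp (-(s * p) - δ) ^ n := by
        gcongr
        exact sum_exp_le hA hξ hZ hp n s
    _ = (Z * ((1 + p * (Real.exp s - 1)) * Real.exp (-(s * p) - δ))) ^ n := by
        rw [← mul_pow, mul_assoc]
    _ ≤ (Z * (Real.exp (s * p + s ^ 2) * Real.exp (-(s * p) - δ))) ^ n := by
        gcongr
        have := Real.add_one_le_exp (p * (Real.exp s - 1))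
        have := Real.exp_le_exp.2 hquad
        linarith
    _ = _ := by
        rw [← Real.exp_add]
        ring_nf

theorem card_deviation_mul_pow_le (hA : 0 ∉ A) (hξ : 0 < ξ)
    (hZ : HasSum (A.indicator fun k => ξ ^ k) (Z - 1))
    (hp : HasSum ((A ∩ C).indicator fun k => ξ ^ k) (p * Z)) (hZ0 : 0 ≤ Z) (hp0 : 0 ≤ p)
    (hp1 : p ≤ 1) {n : ℕ} (hn : 0 < n) {t : ℝ} (ht0 : 0 ≤ t) (ht1 : t ≤ 1) (ε : ℝ) :
    (((NCPA A n).filter fun P =>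
      ε < |((P.filter fun B => B.card ∈ C).card : ℝ) / n - p|).card : ℝ) * ξ ^ n ≤
      2 * (Z * Real.exp (t ^ 2 - t * ε)) ^ n := by
  have hup := sum_exp_deviation_le hA hξ hZ hp hZ0 hp0 hp1 n (s := t)
    (by rwa [abs_of_nonneg ht0]) (t * ε)
  have hdown := sum_exp_deviation_le hA hξ hZ hp hZ0 hp0 hp1 n (s := -t)
    (by rwa [abs_neg, abs_of_nonneg ht0]) (t * ε)
  rw [neg_sq] at hdown
  have hn' : (0 : ℝ) < n := by exact_mod_cast hn
  have hcard : (((NCPA A n).filter fun P =>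
      ε < |((P.filter fun B => B.card ∈ C).card : ℝ) / n - p|).card : ℝ) ≤
      ∑ P ∈ NCPA A n,
        (Real.exp (t * ((P.filter fun B => B.card ∈ C).card - p * n) - t * ε * n) +
        Real.exp (-t * ((P.filter fun B => B.card ∈ C).card - p * n) - t * ε * n)) := by
    rw [Finset.card_eq_sum_ones, Nat.cast_sum, Finset.sum_filter]
    refine Finset.sum_le_sum fun P _ => ?_
    set x : ℝ := ((P.filter fun B => B.card ∈ C).card : ℝ)
    split_ifs with hdev
    · have hdiv : x / n - p = (x - p * n) / n := by field_simp
      rw [hdiv, lt_abs, ← neg_div, lt_div_iff₀ hn', lt_div_iff₀ hn'] at hdev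
      rw [Nat.cast_one]
      rcases hdev with hdev | hdev
      · have : 1 ≤ Real.exp (t * (x - p * n) - t * ε * n) := Real.one_le_exp (by nlinarith)
        linarith [Real.exp_pos (-t * (x - p * n) - t * ε * n)]
      · have : 1 ≤ Real.exp (-t * (x - p * n) - t * ε * n) := Real.one_le_exp (by nlinarith)
        linarith [Real.exp_pos (t * (x - p * n) - t * ε * n)]
    · positivity
  rw [Finset.sum_add_distrib] at hcard
  have := mul_le_mul_of_nonneg_right hcard (by positivity : 0 ≤ ξ ^ n)
  linarith

/-- The proportion of partitions whose statistic deviates from its limit is exponentially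
small. -/
theorem exists_deviation_le (hA : 0 ∉ A) (hξ : 0 < ξ)
    (hZ : HasSum (A.indicator fun k => ξ ^ k) (Z - 1))
    (hZ' : HasSum (A.indicator fun k => (k : ℝ) * ξ ^ k) Z)
    (hp : HasSum ((A ∩ C).indicator fun k => ξ ^ k) (p * Z)) (hZ0 : 0 < Z) (hp0 : 0 ≤ p)
    (hp1 : p ≤ 1) {ε : ℝ} (hε : 0 < ε) :
    ∃ K θ : ℝ, 0 ≤ θ ∧ θ < 1 ∧ ∀ n, 0 < n → (NCPA A n).Nonempty →
      (((NCPA A n).filter fun P =>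
        ε < |((P.filter fun B => B.card ∈ C).card : ℝ) / n - p|).card : ℝ) /
        (NCPA A n).card ≤ K * θ ^ n := by
  obtain ⟨t, ht0, ht1, htε⟩ : ∃ t : ℝ, 0 < t ∧ t ≤ 1 ∧ t < ε :=
    ⟨min 1 (ε / 2), by positivity, min_le_left _ _, (min_le_right _ _).trans_lt (by linarith)⟩
  set δ := (t * ε - t ^ 2) / 2 with hδ
  have hδ0 : 0 < δ := by rw [hδ]; nlinarith
  set θ := Real.exp (-δ) with hθ
  have hθ0 : 0 < θ := Real.exp_pos _
  have hθ1 : θ < 1 := by rw [hθ, Real.exp_lt_one_iff]; linarith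
  obtain ⟨κ, hκ, hκle⟩ := exists_mul_pow_le_card_NCPA hA hξ hZ hZ' (q := Z / ξ * θ)
    (by positivity) (by
      rw [mul_right_comm, div_mul_cancel₀ _ hξ.ne']
      exact mul_lt_of_lt_one_right hZ0 hθ1)
  refine ⟨2 / κ, θ, hθ0.le, hθ1, fun n hn hne => ?_⟩
  have hcard : 0 < ((NCPA A n).card : ℝ) := by exact_mod_cast hne.card_pos
  have h1 := card_deviation_mul_pow_le hA hξ hZ hp hZ0.le hp0 hp1 hn ht0.le ht1 ε
  have hexp : Real.exp (t ^ 2 - t * ε) = θ * θ := by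
    rw [hθ, ← Real.exp_add, hδ]
    ring_nf
  rw [hexp, ← le_div_iff₀ (by positivity)] at h1
  rw [div_le_iff₀ hcard]
  refine h1.trans ?_
  calc 2 * (Z * (θ * θ)) ^ n / ξ ^ n = 2 / κ * θ ^ n * (κ * (Z / ξ * θ) ^ n) := by
        rw [mul_pow, mul_pow, mul_pow, div_pow]
        field_simp
    _ ≤ _ := by gcongr; exact hκle n hne

end Concentration

theorem card_le_of_isPartitionOf {n : ℕ} {P : Finset (Finset ℕ)} (h : IsPartitionOf n P) :
    P.card ≤ n := by
  have hne : ∀ B ∈ P, ∃ x, x ∈ B := fun B hB => (h.1 B hB).2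
  choose! f hf using hne
  have := Finset.card_le_card_of_injOn (s := P) (t := Finset.Icc 1 n) f
    (fun B hB => (h.1 B hB).1 (hf B hB)) (fun B hB B' hB' heq =>
      (h.2 _ ((h.1 B hB).1 (hf B hB))).unique ⟨hB, hf B hB⟩ ⟨hB', heq ▸ hf B' hB'⟩)
  simpa using this

theorem hasSum_indicator_inter_piA {A C : Set ℕ} {ξ : ℝ} (hC : 0 ∉ C)
    (hZ : 0 < 1 + ∑' i : A, ξ ^ (i : ℕ)) (hA : Summable (A.indicator fun k => ξ ^ k))
    (hξ : 0 < ξ) :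
    HasSum ((A ∩ C).indicator fun k => ξ ^ k)
      ((∑' c : C, piA A ξ (c : ℕ)) * (1 + ∑' i : A, ξ ^ (i : ℕ))) := by
  have hterm : ((A ∩ C).indicator fun k => ξ ^ k) =
      fun k => C.indicator (piA A ξ) k * (1 + ∑' i : A, ξ ^ (i : ℕ)) := by
    funext k
    by_cases hkC : k ∈ C
    · have hk0 : k ≠ 0 := fun h => hC (h ▸ hkC)
      by_cases hkA : k ∈ A <;> simp [hkA, hkC, hk0, piA, hZ.ne']
    · simp [hkC]
  have hs : Summable ((A ∩ C).indicator fun k => ξ ^ k) :=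
    hA.of_nonneg_of_le (fun k => Set.indicator_nonneg (fun _ _ => by positivity) k)
      (fun k => Set.indicator_le_indicator_of_subset Set.inter_subset_left
        (fun _ => by positivity) k)
  rw [tsum_subtype C (piA A ξ), ← tsum_mul_right, ← hterm]
  exact hs.hasSum

/-- Bounded random variables that converge in probability converge in mean; here for the uniform
measure on finite sets. -/
theorem tendsto_average_of_tendsto_deviation {α : Type*} {l : Filter ℕ} {s : ℕ → Finset α}
    {X : ℕ → α → ℝ} {p : ℝ} (hs : ∀ᶠ n in l, (s n).Nonempty)
    (hX : ∀ᶠ n in l, ∀ a ∈ s n, |X n a - p| ≤ 1)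
    (h : ∀ ε : ℝ, 0 < ε → Filter.Tendsto
      (fun n => (((s n).filter fun a => ε < |X n a - p|).card : ℝ) / (s n).card) l (nhds 0)) :
    Filter.Tendsto (fun n => (∑ a ∈ s n, X n a) / (s n).card) l (nhds p) := by
  rw [Metric.tendsto_nhds]
  intro ε hε
  have hε2 : 0 < ε / 2 := by positivity
  filter_upwards [hs, hX, (h (ε / 2) hε2).eventually (gt_mem_nhds hε2)] with n hsn hXn hn
  have hcard : 0 < ((s n).card : ℝ) := by exact_mod_cast hsn.card_pos
  have hbound : ∑ a ∈ s n, |X n a - p| ≤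
      ((s n).filter fun a => ε / 2 < |X n a - p|).card + ε / 2 * (s n).card := by
    calc _ ≤ ∑ a ∈ s n, ((if ε / 2 < |X n a - p| then 1 else 0) + ε / 2) := by
          refine Finset.sum_le_sum fun a ha => ?_
          have := hXn a ha
          split_ifs <;> linarith
      _ = _ := by
          rw [Finset.sum_add_distrib, Finset.sum_boole, Finset.sum_const, nsmul_eq_mul, mul_comm]
  have hdiff : (∑ a ∈ s n, X n a) / (s n).card - p = (∑ a ∈ s n, (X n a - p)) / (s n).card := by
    rw [Finset.sum_sub_distrib, Finset.sum_const, nsmul_eq_mul]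
    field_simp
  rw [Real.dist_eq, hdiff, abs_div, abs_of_pos hcard, div_lt_iff₀ hcard]
  rw [div_lt_iff₀ hcard] at hn
  linarith [Finset.abs_sum_le_sum_abs (fun a => X n a - p) (s n)]

/-- for a uniform non-crossing partition of `[n]` with block sizes in `A`,
the number `ζ_C` of blocks with size in `C` satisfies `ζ_C/n → π_A(C)` in probability,
and in expectation. -/
theorem stmt2 (A : Set ℕ) (hA : A.Nonempty) (hApos : ∀ a ∈ A, 1 ≤ a) (hA1 : A ≠ {1})
    (ξ : ℝ) (hξpos : 0 < ξ)
    (hξsum : Summable fun i : A => (i : ℝ) * ξ ^ (i : ℕ))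
    (hξeq : 1 + ∑' i : A, ξ ^ (i : ℕ) = ∑' i : A, (i : ℝ) * ξ ^ (i : ℕ))
    (C : Set ℕ) (hC : C.Nonempty) (hCpos : ∀ c ∈ C, 1 ≤ c) :
    (∀ ε : ℝ, 0 < ε →
      Filter.Tendsto
        (fun n : ℕ =>
          (((NCPA A n).filter fun P =>
              ε < |((P.filter fun B => B.card ∈ C).card : ℝ) / (n : ℝ) -
                    ∑' c : C, piA A ξ (c : ℕ)|).card : ℝ) /
            ((NCPA A n).card : ℝ))
        (Filter.atTop ⊓ Filter.principal {n : ℕ | (NCPA A n).Nonempty})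
        (nhds 0)) ∧
    Filter.Tendsto
      (fun n : ℕ =>
        (∑ P ∈ NCPA A n, ((P.filter fun B => B.card ∈ C).card : ℝ)) /
          ((n : ℝ) * ((NCPA A n).card : ℝ)))
      (Filter.atTop ⊓ Filter.principal {n : ℕ | (NCPA A n).Nonempty})
      (nhds (∑' c : C, piA A ξ (c : ℕ))) := by
  have hA0 : 0 ∉ A := fun h => absurd (hApos 0 h) (by norm_num)
  have hC0 : 0 ∉ C := fun h => absurd (hCpos 0 h) (by norm_num)
  have hsum' : HasSum (A.indicator fun k => (k : ℝ) * ξ ^ k)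
      (1 + ∑' i : A, ξ ^ (i : ℕ)) := by
    rw [hξeq]
    exact (hasSum_subtype_iff_indicator (f := fun k : ℕ => (k : ℝ) * ξ ^ k)).1 hξsum.hasSum
  have hA_sum : Summable (A.indicator fun k => ξ ^ k) := by
    refine hsum'.summable.of_nonneg_of_le
      (fun k => Set.indicator_nonneg (fun _ _ => by positivity) k) fun k => ?_
    by_cases hk : k ∈ A
    · simp only [Set.indicator_of_mem hk]
      exact le_mul_of_one_le_left (by positivity) (by exact_mod_cast hApos k hk)
    · simp only [Set.indicator_of_notMem hk, le_refl]
  have hZ : HasSum (A.indicator fun k => ξ ^ k) (1 + ∑' i : A, ξ ^ (i : ℕ) - 1) := by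
    rw [add_sub_cancel_left, tsum_subtype A fun k => ξ ^ k]
    exact hA_sum.hasSum
  have hZ0 : 0 < 1 + ∑' i : A, ξ ^ (i : ℕ) := by positivity
  have hp := hasSum_indicator_inter_piA hC0 hZ0 hA_sum hξpos
  have hp0 : 0 ≤ ∑' c : C, piA A ξ (c : ℕ) := tsum_nonneg fun c => by
    unfold piA
    split_ifs <;> positivity
  have hp1 : ∑' c : C, piA A ξ (c : ℕ) ≤ 1 := by
    have := hasSum_le (fun k => Set.indicator_le_indicator_of_subset Set.inter_subset_left
      (fun _ => by positivity) k) hp hZ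
    exact le_of_mul_le_mul_right (by linarith) hZ0
  set p := ∑' c : C, piA A ξ (c : ℕ)
  have hne : ∀ᶠ n in Filter.atTop ⊓ Filter.principal {n : ℕ | (NCPA A n).Nonempty},
      (NCPA A n).Nonempty := Filter.eventually_inf_principal.2 (Filter.Eventually.of_forall
        fun _ h => h)
  have hpos : ∀ᶠ n in Filter.atTop ⊓ Filter.principal {n : ℕ | (NCPA A n).Nonempty}, 0 < n :=
    (Filter.eventually_gt_atTop 0).filter_mono inf_le_left
  have hprob : ∀ ε : ℝ, 0 < ε → Filter.Tendsto (fun n : ℕ => (((NCPA A n).filter fun P =>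
      ε < |((P.filter fun B => B.card ∈ C).card : ℝ) / (n : ℝ) - p|).card : ℝ) /
        ((NCPA A n).card : ℝ))
      (Filter.atTop ⊓ Filter.principal {n : ℕ | (NCPA A n).Nonempty}) (nhds 0) := by
    intro ε hε
    obtain ⟨K, θ, hθ0, hθ1, hle⟩ := exists_deviation_le hA0 hξpos hZ hsum' hp hZ0 hp0 hp1 hε
    refine squeeze_zero' (Filter.Eventually.of_forall fun n => by positivity)
      (by filter_upwards [hne, hpos] with n h1 h2 using hle n h2 h1) ?_
    have := (tendsto_pow_atTop_nhds_zero_of_lt_one hθ0 hθ1).const_mul K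
    rw [mul_zero] at this
    exact this.mono_left inf_le_left
  refine ⟨hprob, ?_⟩
  have havg := tendsto_average_of_tendsto_deviation (s := fun n => NCPA A n) hne ?_ hprob
  · refine havg.congr fun n => ?_
    rw [← Finset.sum_div, div_div]
  · filter_upwards [hpos] with n hn P hP
    have hcard : (P.filter fun B => B.card ∈ C).card ≤ n := (Finset.card_filter_le _ _).trans
      (card_le_of_isPartitionOf (mem_NCP.1 (Finset.mem_filter.1 hP).1).1)
    have hn' : (0 : ℝ) < n := by exact_mod_cast hn
    have h0 : 0 ≤ ((P.filter fun B => B.card ∈ C).card : ℝ) / n := by positivity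
    have h1 : ((P.filter fun B => B.card ∈ C).card : ℝ) / n ≤ 1 :=
      (div_le_one hn').2 (by exact_mod_cast hcard)
    exact abs_le.2 ⟨by linarith, by linarith⟩
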